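/- arXiv:2010.00103 — 2 statements merged into one kernel-verified Lean document; each statement's English description precedes it below -/
import Mathlib

section
/- Let N be a weight sequence in the class 𝓛𝓒 satisfying (γ₁) (hence N is nonquasianalytic), let s ∈ ℕ_{>0}, and let C be a real number with C ≥ sup_{p≥1} (ν_p/p)·∑_{k≥p} 1/ν_k. Then for every p ≥ 1 the minimum defining L^{s,C}_p is attained at j = p−1; that is, L^{s,C}_p = (Cp/∑_{k≥p} 1/ν_k)·s^p·N_{p−1} for all p ∈ ℕ_{>0}. -/
open Filter

noncomputable def nuq (N : ℕ → ℝ) (p : ℕ) : ℝ := N p / N (p - 1)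

def IsLC (N : ℕ → ℝ) : Prop :=
  (∀ p, 0 < N p) ∧ N 0 = 1 ∧ N 0 ≤ N 1 ∧
    (∀ p, 1 ≤ p → (N p) ^ 2 ≤ N (p - 1) * N (p + 1)) ∧
    Tendsto (fun p : ℕ => (N p) ^ ((1 : ℝ) / p)) atTop atTop

def NQA (N : ℕ → ℝ) : Prop := Summable (fun p : ℕ => 1 / nuq N (p + 1))

noncomputable def tailSum (N : ℕ → ℝ) (p : ℕ) : ℝ := ∑' k : ℕ, 1 / nuq N (p + k)

noncomputable def lamSV (M N : ℕ → ℝ) (s p : ℕ) : ℝ :=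
  ⨆ j : Fin p, (M p / ((s : ℝ) ^ p * N j)) ^ ((1 : ℝ) / ((p : ℝ) - (j : ℕ)))

def SVcond (M N : ℕ → ℝ) : Prop :=
  ∃ s : ℕ, 1 ≤ s ∧ ∃ B : ℝ, ∀ p : ℕ, 1 ≤ p → lamSV M N s p / p * tailSum N p ≤ B

noncomputable def Lseq (N : ℕ → ℝ) (s p : ℕ) : ℝ :=
  if p = 0 then 1
  else (s : ℝ) ^ p * ⨅ j : Fin p, ((p : ℝ) / tailSum N p) ^ (p - (j : ℕ)) * N j

noncomputable def LseqC (N : ℕ → ℝ) (s : ℕ) (C : ℝ) (p : ℕ) : ℝ :=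
  if p = 0 then 1
  else (s : ℝ) ^ p * ⨅ j : Fin p, (C * p / tailSum N p) ^ (p - (j : ℕ)) * N j

def Preceq (M N : ℕ → ℝ) : Prop :=
  ∃ B : ℝ, ∀ p : ℕ, 1 ≤ p → (M p / N p) ^ ((1 : ℝ) / p) ≤ B

def SeqEquiv (M N : ℕ → ℝ) : Prop := Preceq M N ∧ Preceq N M

def Gamma1 (N : ℕ → ℝ) : Prop :=
  ∃ B : ℝ, ∀ p : ℕ, 1 ≤ p → nuq N p / p * tailSum N p ≤ B

def MG (N : ℕ → ℝ) : Prop :=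
  ∃ C : ℝ, 1 ≤ C ∧ ∀ j k : ℕ, N (j + k) ≤ C ^ (j + k) * N j * N k

noncomputable def tauD (N : ℕ → ℝ) (p : ℕ) : ℝ := p / nuq N p + tailSum N p

noncomputable def sigmaD (N : ℕ → ℝ) (p : ℕ) : ℝ :=
  if p = 0 then 1 else tauD N 1 * p / tauD N p

noncomputable def Sdesc (N : ℕ → ℝ) (p : ℕ) : ℝ :=
  ∏ i ∈ Finset.range (p + 1), sigmaD N i

def AlmostIncreasing (a : ℕ → ℝ) : Prop :=
  ∃ C : ℝ, 1 ≤ C ∧ ∀ p q : ℕ, 1 ≤ p → p ≤ q → a p ≤ C * a q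

noncomputable def BorelMap (f : ℝ → ℂ) : ℕ → ℂ := fun p => iteratedDeriv p f 0

def DRoumieu (N : ℕ → ℝ) : Set (ℝ → ℂ) :=
  {f | ContDiff ℝ (⊤ : ℕ∞) f ∧ Function.support f ⊆ Set.Icc (-1 : ℝ) 1 ∧
    ∃ C h : ℝ, 0 < C ∧ 0 < h ∧ ∀ p x, ‖iteratedDeriv p f x‖ ≤ C * h ^ p * N p}

def LambdaRoumieu (M : ℕ → ℝ) : Set (ℕ → ℂ) :=
  {a | ∃ C h : ℝ, 0 < C ∧ 0 < h ∧ ∀ p, ‖a p‖ ≤ C * h ^ p * M p}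

def DBeurling (N : ℕ → ℝ) : Set (ℝ → ℂ) :=
  {f | ContDiff ℝ (⊤ : ℕ∞) f ∧ Function.support f ⊆ Set.Icc (-1 : ℝ) 1 ∧
    ∀ h : ℝ, 0 < h → ∃ C : ℝ, 0 < C ∧ ∀ p x, ‖iteratedDeriv p f x‖ ≤ C * h ^ p * N p}

def LambdaBeurling (M : ℕ → ℝ) : Set (ℕ → ℂ) :=
  {a | ∀ h : ℝ, 0 < h → ∃ C : ℝ, 0 < C ∧ ∀ p, ‖a p‖ ≤ C * h ^ p * M p}

theorem nuq_le_nuq_of_logConvex {N : ℕ → ℝ} (hpos : ∀ p, 0 < N p)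
    (hlc : ∀ p, 1 ≤ p → (N p) ^ 2 ≤ N (p - 1) * N (p + 1)) {i p : ℕ} (hi : 1 ≤ i) (hip : i ≤ p) :
    nuq N i ≤ nuq N p := by
  induction p, hip using Nat.le_induction with
  | base => exact le_rfl
  | succ n hn ih =>
    refine ih.trans ?_
    have h := hlc n (hi.trans hn)
    simp only [nuq, Nat.add_sub_cancel]
    rw [div_le_div_iff₀ (hpos _) (hpos _)]
    linarith

theorem le_pow_mul_of_nuq_le {N : ℕ → ℝ} (hpos : ∀ p, 0 < N p)
    {x : ℝ} (j d : ℕ) (hx : ∀ i, 1 ≤ i → i ≤ j + d → nuq N i ≤ x) :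
    N (j + d) ≤ x ^ d * N j := by
  induction d with
  | zero => simp
  | succ d ih =>
    have h : N (j + (d + 1)) / N (j + d) ≤ x := hx (j + (d + 1)) (by omega) le_rfl
    have hx0 : 0 ≤ x := (div_pos (hpos _) (hpos _)).le.trans h
    calc N (j + (d + 1)) ≤ x * N (j + d) := (div_le_iff₀ (hpos _)).1 h
      _ ≤ x * (x ^ d * N j) :=
        mul_le_mul_of_nonneg_left (ih fun i hi hid => hx i hi (by omega)) hx0
      _ = x ^ (d + 1) * N j := by ring

theorem tailSum_nonneg {N : ℕ → ℝ} (hpos : ∀ p, 0 < N p) (p : ℕ) : 0 ≤ tailSum N p :=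
  tsum_nonneg fun _ => (one_div_pos.2 (div_pos (hpos _) (hpos _))).le

theorem stmt3 (N : ℕ → ℝ) (hN : IsLC N) (hγ : Gamma1 N)
    (s : ℕ) (hs : 1 ≤ s) (C : ℝ)
    (hC : ∀ p : ℕ, 1 ≤ p → nuq N p / p * tailSum N p ≤ C) :
    ∀ p : ℕ, 1 ≤ p →
      LseqC N s C p = (C * p / tailSum N p) * (s : ℝ) ^ p * N (p - 1) := by
  obtain ⟨hpos, -, -, hlc, -⟩ := hN
  intro p hp
  set x : ℝ := C * p / tailSum N p with hx
  have hmin : ∀ j : Fin p, x * N (p - 1) ≤ x ^ (p - (j : ℕ)) * N j := by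
    intro j
    rcases (tailSum_nonneg hpos p).eq_or_lt with hT | hT
    · have hx0 : x = 0 := by rw [hx, ← hT, div_zero]
      simp [hx0, zero_pow (Nat.sub_pos_of_lt j.isLt).ne']
    · have hp0 : (0 : ℝ) < p := by exact_mod_cast hp
      have hνx : nuq N p ≤ x := by
        have h := hC p hp
        rw [div_mul_eq_mul_div, div_le_iff₀ hp0] at h
        rwa [hx, le_div_iff₀ hT]
      have hx0 : 0 ≤ x := (div_pos (hpos _) (hpos _)).le.trans hνx
      obtain ⟨d, hd⟩ : ∃ d, p = j + d + 1 := ⟨p - j - 1, by omega⟩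
      have hN : N (j + d) ≤ x ^ d * N j := le_pow_mul_of_nuq_le hpos _ _ fun i hi hid =>
        (nuq_le_nuq_of_logConvex hpos hlc hi (by omega)).trans hνx
      rw [show p - 1 = j + d by omega, show p - (j : ℕ) = d + 1 by omega, pow_succ', mul_assoc]
      exact mul_le_mul_of_nonneg_left hN hx0
  have hinf : ⨅ j : Fin p, x ^ (p - (j : ℕ)) * N j = x * N (p - 1) := by
    have : Nonempty (Fin p) := ⟨⟨0, hp⟩⟩
    refine le_antisymm ?_ (le_ciInf hmin)
    refine (ciInf_le (Set.finite_range _).bddBelow (⟨p - 1, by omega⟩ : Fin p)).trans_eq ?_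
    simp [Nat.sub_sub_self hp]
  rw [LseqC, if_neg (by omega), ← hx, hinf]
  ring
end

section
/- Let N be a weight sequence in the class 𝓛𝓒 which is nonquasianalytic. If N ≈ L^s for some s ∈ ℕ_{>0}, then N satisfies (γ₁). -/
open Filter

theorem nuq_pos {N : ℕ → ℝ} (hpos : ∀ p, 0 < N p) (p : ℕ) : 0 < nuq N p :=
  div_pos (hpos _) (hpos _)

theorem nuq_le_nuq_succ {N : ℕ → ℝ} (hpos : ∀ p, 0 < N p)
    (hconv : ∀ p, 1 ≤ p → (N p) ^ 2 ≤ N (p - 1) * N (p + 1)) {p : ℕ} (hp : 1 ≤ p) :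
    nuq N p ≤ nuq N (p + 1) := by
  have h := hconv p hp
  rw [nuq, nuq, Nat.add_sub_cancel, div_le_div_iff₀ (hpos _) (hpos _)]
  linarith

theorem nuq_le_nuq_add {N : ℕ → ℝ} (hpos : ∀ p, 0 < N p)
    (hconv : ∀ p, 1 ≤ p → (N p) ^ 2 ≤ N (p - 1) * N (p + 1)) {p : ℕ} (hp : 1 ≤ p) (k : ℕ) :
    nuq N p ≤ nuq N (p + k) := by
  induction k with
  | zero => exact le_rfl
  | succ k ih => exact ih.trans (nuq_le_nuq_succ hpos hconv (hp.trans (Nat.le_add_right p k)))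

theorem nuq_pow_mul_le {N : ℕ → ℝ} (hpos : ∀ p, 0 < N p)
    (hconv : ∀ p, 1 ≤ p → (N p) ^ 2 ≤ N (p - 1) * N (p + 1)) {p : ℕ} (hp : 1 ≤ p) (m : ℕ) :
    nuq N p ^ m * N p ≤ N (p + m) := by
  induction m with
  | zero => simp
  | succ m ih =>
    have hstep : N (p + (m + 1)) = nuq N (p + (m + 1)) * N (p + m) := by
      rw [nuq, ← add_assoc, Nat.add_sub_cancel, div_mul_cancel₀ _ (hpos _).ne']
    calc nuq N p ^ (m + 1) * N p = nuq N p * (nuq N p ^ m * N p) := by ring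
      _ ≤ nuq N (p + (m + 1)) * N (p + m) :=
        mul_le_mul (nuq_le_nuq_add hpos hconv hp _) ih
          (mul_nonneg (pow_nonneg (nuq_pos hpos p).le _) (hpos p).le) (nuq_pos hpos _).le
      _ = N (p + (m + 1)) := hstep.symm

theorem NQA.summable_tail {N : ℕ → ℝ} (hnq : NQA N) (p : ℕ) :
    Summable (fun k : ℕ => 1 / nuq N (p + k)) := by
  have h : Summable (fun k : ℕ => 1 / nuq N k) :=
    (summable_nat_add_iff (f := fun k : ℕ => 1 / nuq N k) 1).1 hnq
  simpa only [add_comm] using (summable_nat_add_iff (f := fun k : ℕ => 1 / nuq N k) p).2 h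

theorem tailSum_pos {N : ℕ → ℝ} (hpos : ∀ p, 0 < N p) (hnq : NQA N) (p : ℕ) :
    0 < tailSum N p :=
  (hnq.summable_tail p).tsum_pos (fun _ => (one_div_pos.2 (nuq_pos hpos _)).le) 0
    (one_div_pos.2 (nuq_pos hpos _))

theorem tailSum_le {N : ℕ → ℝ} (hpos : ∀ p, 0 < N p)
    (hconv : ∀ p, 1 ≤ p → (N p) ^ 2 ≤ N (p - 1) * N (p + 1)) (hnq : NQA N)
    {p : ℕ} (hp : 1 ≤ p) (m : ℕ) :
    tailSum N p ≤ m / nuq N p + tailSum N (p + m) := by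
  have hsplit := (hnq.summable_tail p).sum_add_tsum_nat_add m
  have htail : ∑' k : ℕ, 1 / nuq N (p + (k + m)) = tailSum N (p + m) := by
    rw [tailSum]
    exact tsum_congr fun k => by rw [add_comm k m, add_assoc]
  have hhead : ∑ k ∈ Finset.range m, 1 / nuq N (p + k) ≤ m / nuq N p := by
    calc ∑ k ∈ Finset.range m, 1 / nuq N (p + k) ≤ ∑ _k ∈ Finset.range m, 1 / nuq N p :=
          Finset.sum_le_sum fun k _ =>
            one_div_le_one_div_of_le (nuq_pos hpos p) (nuq_le_nuq_add hpos hconv hp k)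
      _ = m / nuq N p := by simp [div_eq_mul_inv]
  rw [htail] at hsplit
  rw [← show _ = tailSum N p from hsplit]
  linarith

theorem Lseq_le {N : ℕ → ℝ} (s : ℕ) {p j : ℕ} (hj : j < p) :
    Lseq N s p ≤ (s : ℝ) ^ p * (((p : ℝ) / tailSum N p) ^ (p - j) * N j) := by
  rw [Lseq, if_neg (by omega)]
  exact mul_le_mul_of_nonneg_left (ciInf_le (Set.finite_range _).bddBelow (⟨j, hj⟩ : Fin p))
    (by positivity)

theorem Lseq_pos {N : ℕ → ℝ} (hpos : ∀ p, 0 < N p) (hnq : NQA N) {s p : ℕ} (hs : 1 ≤ s)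
    (hp : 1 ≤ p) : 0 < Lseq N s p := by
  rw [Lseq, if_neg (by omega)]
  have : Nonempty (Fin p) := ⟨⟨0, hp⟩⟩
  have hs' : (0 : ℝ) < s := by exact_mod_cast hs
  have hp' : (0 : ℝ) < p := by exact_mod_cast hp
  obtain ⟨i, hi⟩ := exists_eq_ciInf_of_finite
    (f := fun j : Fin p => ((p : ℝ) / tailSum N p) ^ (p - (j : ℕ)) * N j)
  rw [← hi]
  exact mul_pos (pow_pos hs' _)
    (mul_pos (pow_pos (div_pos hp' (tailSum_pos hpos hnq p)) _) (hpos _))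

theorem Preceq.exists_le_pow_mul {M N : ℕ → ℝ} (h : Preceq M N) (hM : ∀ p, 1 ≤ p → 0 < M p)
    (hN : ∀ p, 1 ≤ p → 0 < N p) :
    ∃ B : ℝ, 0 < B ∧ ∀ p, 1 ≤ p → M p ≤ B ^ p * N p := by
  obtain ⟨B, hB⟩ := h
  have hquot : ∀ p, 1 ≤ p → 0 < M p / N p := fun p hp => div_pos (hM p hp) (hN p hp)
  refine ⟨B, (Real.rpow_pos_of_pos (hquot 1 le_rfl) _).trans_le (hB 1 le_rfl), fun p hp => ?_⟩
  rw [← div_le_iff₀ (hN p hp)]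
  have hpow := pow_le_pow_left₀ (Real.rpow_nonneg (hquot p hp).le _) (hB p hp) p
  rwa [one_div, Real.rpow_inv_natCast_pow (hquot p hp).le (by omega)] at hpow

theorem stmt5 (N : ℕ → ℝ) (hN : IsLC N) (hnq : NQA N)
    (hequiv : ∃ s : ℕ, 1 ≤ s ∧ SeqEquiv N (Lseq N s)) :
    Gamma1 N := by
  obtain ⟨hpos, -, -, hconv, -⟩ := hN
  obtain ⟨s, hs, hle, -⟩ := hequiv
  obtain ⟨B, hB, hNL⟩ := hle.exists_le_pow_mul (fun p _ => hpos p)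
    (fun p hp => Lseq_pos hpos hnq hs hp)
  refine ⟨1 + 2 * (B * s) ^ 2, fun p hp => ?_⟩
  have hp' : (0 : ℝ) < p := by exact_mod_cast hp
  have hν := nuq_pos hpos p
  have hT := tailSum_pos hpos hnq (p + p)
  have hpow : nuq N p ^ p ≤ ((B * s) ^ 2 * (((p + p : ℕ) : ℝ) / tailSum N (p + p))) ^ p := by
    refine le_of_mul_le_mul_right ?_ (hpos p)
    calc nuq N p ^ p * N p ≤ N (p + p) := nuq_pow_mul_le hpos hconv hp p
      _ ≤ B ^ (p + p) * Lseq N s (p + p) := hNL _ (by omega)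
      _ ≤ B ^ (p + p) * ((s : ℝ) ^ (p + p) *
          ((((p + p : ℕ) : ℝ) / tailSum N (p + p)) ^ (p + p - p) * N p)) :=
        mul_le_mul_of_nonneg_left (Lseq_le s (by omega)) (by positivity)
      _ = ((B * s) ^ 2 * (((p + p : ℕ) : ℝ) / tailSum N (p + p))) ^ p * N p := by
        rw [Nat.add_sub_cancel, mul_pow _ _ p, ← pow_mul, two_mul, mul_pow]
        ring
  have hroot := le_of_pow_le_pow_left₀ (by omega) (by positivity) hpow
  rw [← mul_div_assoc, le_div_iff₀ hT] at hroot
  push_cast at hroot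
  have htail := mul_le_mul_of_nonneg_left (tailSum_le hpos hconv hnq hp p) hν.le
  rw [mul_add, mul_div_cancel₀ _ hν.ne'] at htail
  rw [div_mul_eq_mul_div, div_le_iff₀ hp']
  linarith
end
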